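/- Let Q be the transient block of the transition matrix of a finite absorbing Markov chain. Then the series Σ_{n=0}^∞ Qⁿ converges entrywise, and its sum equals (I − Q)⁻¹. (In particular, for transient states u and j, the expected number of visits to j starting from u, namely Σ_{n=0}^∞ (Qⁿ)_{uj}, equals N_{uj} where N = (I − Q)⁻¹.) -/

import Mathlib

/-- A bounded-power matrix with nonnegative entries for which `1 - A` is invertible has a convergent
Neumann series. -/
theorem Matrix.hasSum_pow_apply_of_isUnit_one_sub {ι : Type*} [Fintype ι] [DecidableEq ι]
    {A : Matrix ι ι ℝ} {C : ℝ} (h_nonneg : ∀ n i j, 0 ≤ (A ^ n) i j)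
    (h_le : ∀ n i j, (A ^ n) i j ≤ C) (h_unit : IsUnit (1 - A)) (i j : ι) :
    HasSum (fun n : ℕ => (A ^ n) i j) ((1 - A)⁻¹ i j) := by
  have h_det : IsUnit (1 - A).det := (Matrix.isUnit_iff_isUnit_det _).mp h_unit
  have h_partial (n : ℕ) (i j : ι) : ∑ m ∈ Finset.range n, (A ^ m) i j =
      (1 - A)⁻¹ i j - ∑ k, (A ^ n) i k * (1 - A)⁻¹ k j := by
    have h : ∑ m ∈ Finset.range n, A ^ m = (1 - A)⁻¹ - A ^ n * (1 - A)⁻¹ := by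
      rw [← Matrix.mul_nonsing_inv_cancel_right _ (∑ m ∈ Finset.range n, A ^ m) h_det,
        geom_sum_mul_neg, sub_mul, one_mul]
    simpa [Matrix.sum_apply, Matrix.mul_apply] using congrFun (congrFun h i) j
  have h_summable (i j : ι) : Summable fun n : ℕ => (A ^ n) i j := by
    refine summable_of_sum_range_le (c := (1 - A)⁻¹ i j + ∑ k, C * |(1 - A)⁻¹ k j|)
      (fun n => h_nonneg n i j) fun n => ?_
    rw [h_partial, sub_eq_add_neg, ← Finset.sum_neg_distrib]
    gcongr with k
    calc -((A ^ n) i k * (1 - A)⁻¹ k j) ≤ |(A ^ n) i k * (1 - A)⁻¹ k j| := neg_le_abs _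
      _ = (A ^ n) i k * |(1 - A)⁻¹ k j| := by rw [abs_mul, abs_of_nonneg (h_nonneg n i k)]
      _ ≤ C * |(1 - A)⁻¹ k j| := by gcongr; exact h_le n i k
  rw [hasSum_iff_tendsto_nat_of_nonneg fun n => h_nonneg n i j]
  simp only [h_partial]
  have h_zero := tendsto_finsetSum Finset.univ fun k _ =>
    (h_summable i k).tendsto_atTop_zero.mul_const ((1 - A)⁻¹ k j)
  simpa using h_zero.const_sub ((1 - A)⁻¹ i j)

/-- The powers of a matrix with nonnegative entries have nonnegative entries. -/
theorem Matrix.pow_apply_nonneg_of_nonneg {ι : Type*} [Fintype ι] [DecidableEq ι]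
    {A : Matrix ι ι ℝ} (h_nonneg : ∀ i j, 0 ≤ A i j) (n : ℕ) (i j : ι) : 0 ≤ (A ^ n) i j := by
  induction n generalizing i j with
  | zero => rw [pow_zero, Matrix.one_apply]; split_ifs <;> norm_num
  | succ n ih =>
    rw [pow_succ', Matrix.mul_apply]
    exact Finset.sum_nonneg fun k _ => mul_nonneg (h_nonneg i k) (ih k j)

/-- The powers of a substochastic matrix have entries at most `1`. -/
theorem Matrix.pow_apply_le_one_of_substochastic {ι : Type*} [Fintype ι] [DecidableEq ι]
    {A : Matrix ι ι ℝ} (h_nonneg : ∀ i j, 0 ≤ A i j) (h_row : ∀ i, ∑ j, A i j ≤ 1)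
    (n : ℕ) (i j : ι) : (A ^ n) i j ≤ 1 := by
  induction n generalizing i j with
  | zero => rw [pow_zero, Matrix.one_apply]; split_ifs <;> norm_num
  | succ n ih =>
    rw [pow_succ', Matrix.mul_apply]
    exact (Finset.sum_le_sum fun k _ => mul_le_of_le_one_right (h_nonneg i k) (ih k j)).trans
      (h_row i)

/-- Maximum principle: a function that is subharmonic at a maximum point takes the same value at
every state reachable in one step. -/
theorem eq_of_le_sum_mul_of_pos {ι : Type*} [Fintype ι] {p w : ι → ℝ} {c : ℝ}
    (hp : ∀ j, 0 ≤ p j) (hsum : ∑ j, p j = 1) (hw : ∀ j, w j ≤ c) (hc : c ≤ ∑ j, p j * w j)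
    {j : ι} (hj : 0 < p j) : w j = c := by
  have h_nonneg : ∀ k ∈ Finset.univ, 0 ≤ p k * (c - w k) := fun k _ =>
    mul_nonneg (hp k) (sub_nonneg.mpr (hw k))
  have h_sum : ∑ k, p k * (c - w k) = c - ∑ k, p k * w k := by
    simp only [mul_sub, Finset.sum_sub_distrib, ← Finset.sum_mul, hsum, one_mul]
  have h_zero : ∑ k, p k * (c - w k) = 0 :=
    le_antisymm (by linarith) (Finset.sum_nonneg h_nonneg)
  have h := (Finset.sum_eq_zero_iff_of_nonneg h_nonneg).mp h_zero j (Finset.mem_univ j)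
  rcases mul_eq_zero.mp h with h | h <;> linarith

/-- For the transient block `Q` of the transition matrix of a finite
absorbing Markov chain, the series `∑ₙ Qⁿ` converges entrywise and its sum is
`(I - Q)⁻¹ = N`; in particular the expected number of visits to `j` starting from `u`,
namely `∑ₙ (Qⁿ)_{u j}`, equals `N_{u j}`. -/
theorem engel_sum_Q_pow_eq_inv
    (r s : ℕ) (hr : 1 ≤ r) (hrs : r < s)
    (P : Matrix (Fin s) (Fin s) ℝ)
    (hnonneg : ∀ i j, 0 ≤ P i j)
    (hrow : ∀ i, ∑ j, P i j = 1)
    (hdiag : ∀ j : Fin s, r ≤ (j : ℕ) → P j j = 1)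
    (habsorbing : ∀ i : Fin s, (i : ℕ) < r →
      ∃ (m : ℕ) (f : ℕ → Fin s), f 0 = i ∧ (∀ k < m, 0 < P (f k) (f (k + 1))) ∧
        r ≤ ((f m : Fin s) : ℕ))
    (Q : Matrix (Fin r) (Fin r) ℝ)
    (hQ : ∀ i j : Fin r, Q i j = P (Fin.castLE hrs.le i) (Fin.castLE hrs.le j)) :
    ∀ u j : Fin r,
      HasSum (fun n : ℕ => (Q ^ n) u j) ((1 - Q)⁻¹ u j) := by
  have hQ_nonneg (i j : Fin r) : 0 ≤ Q i j := hQ i j ▸ hnonneg _ _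
  have h_inj : Function.Injective (Fin.castLE hrs.le) := Fin.castLE_injective hrs.le
  have hQ_row (i : Fin r) : ∑ j, Q i j ≤ 1 := by
    simp only [hQ]
    rw [← hrow (Fin.castLE hrs.le i),
      ← Finset.sum_image (f := P (Fin.castLE hrs.le i)) h_inj.injOn]
    exact Finset.sum_le_sum_of_subset_of_nonneg (Finset.subset_univ _) fun _ _ _ => hnonneg _ _
  refine Matrix.hasSum_pow_apply_of_isUnit_one_sub (Matrix.pow_apply_nonneg_of_nonneg hQ_nonneg)
    (Matrix.pow_apply_le_one_of_substochastic hQ_nonneg hQ_row) ?_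
  rw [Matrix.isUnit_iff_isUnit_det, isUnit_iff_ne_zero]
  intro h_det
  obtain ⟨v, hv_ne, hv⟩ := Matrix.exists_mulVec_eq_zero_iff.mpr h_det
  rw [Matrix.sub_mulVec, Matrix.one_mulVec, sub_eq_zero] at hv
  have : Nonempty (Fin r) := ⟨⟨0, hr⟩⟩
  obtain ⟨i, hi⟩ := Finite.exists_max fun k => |v k|
  have hi_pos : 0 < |v i| := by
    obtain ⟨k, hk⟩ := Function.ne_iff.mp hv_ne
    exact (abs_pos.mpr hk).trans_le (hi k)
  -- `w` extends `|v|` by zero to the absorbing states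
  let w : Fin s → ℝ := fun k => if h : (k : ℕ) < r then |v ⟨k, h⟩| else 0
  have hw_cast (k : Fin r) : w (Fin.castLE hrs.le k) = |v k| := by simp [w]
  have hw_absorbing {k : Fin s} (h : r ≤ (k : ℕ)) : w k = 0 := dif_neg h.not_gt
  have hw_le (k : Fin s) : w k ≤ |v i| := by
    by_cases h : (k : ℕ) < r
    · simpa [w, h] using hi ⟨k, h⟩
    · rw [hw_absorbing (not_lt.mp h)]; exact hi_pos.le
  have hw_sub {k : Fin s} (h : (k : ℕ) < r) : w k ≤ ∑ l, P k l * w l := by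
    obtain ⟨k, rfl⟩ : ∃ k' : Fin r, Fin.castLE hrs.le k' = k := ⟨⟨k, h⟩, rfl⟩
    rw [hw_cast, ← Fintype.sum_of_injective _ h_inj (fun l => Q k l * |v l|) _
      (fun l hl => ?_) (fun l => by rw [hQ, hw_cast])]
    · calc |v k| = |∑ l, Q k l * v l| := congrArg abs (congrFun hv k)
        _ ≤ ∑ l, |Q k l * v l| := Finset.abs_sum_le_sum_abs _ _
        _ = ∑ l, Q k l * |v l| := by simp only [abs_mul, abs_of_nonneg (hQ_nonneg _ _)]
    · rw [hw_absorbing (not_lt.mp fun h => hl ⟨⟨l, h⟩, rfl⟩), mul_zero]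
  obtain ⟨m, f, hf_zero, hf_pos, hf_absorbing⟩ := habsorbing (Fin.castLE hrs.le i) i.isLt
  have hw_path : ∀ k ≤ m, w (f k) = |v i| := by
    intro k
    induction k with
    | zero => intro _; rw [hf_zero, hw_cast]
    | succ k ih =>
      intro hk
      have h_eq := ih (Nat.le_of_succ_le hk)
      have h_lt : (f k : ℕ) < r := by
        by_contra! h
        exact hi_pos.ne' (h_eq.symm.trans (hw_absorbing h))
      exact eq_of_le_sum_mul_of_pos (hnonneg (f k)) (hrow (f k)) hw_le
        (h_eq ▸ hw_sub h_lt) (hf_pos k hk)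
  exact hi_pos.ne' ((hw_path m le_rfl).symm.trans (hw_absorbing hf_absorbing))
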